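/- arXiv:1905.11368 — 5 statements merged into one kernel-verified Lean document; each statement's English description precedes it below -/
import Mathlib

section
/- Let θ(0) ∈ ℝ^N, let φ(x_1),…,φ(x_n) ∈ ℝ^N be fixed feature vectors, let ỹ = (ỹ_1,…,ỹ_n)ᵀ ∈ ℝ^n, and let λ > 0, η > 0. Define the two objectives L̃^RDI(θ) = (1/2)·Σ_{i=1}^n (φ(x_i)ᵀ(θ − θ(0)) − ỹ_i)² + (λ²/2)·‖θ − θ(0)‖² and L̃^AUX(θ, b) = (1/2)·Σ_{i=1}^n (φ(x_i)ᵀ(θ − θ(0)) + λ b_i − ỹ_i)² for b ∈ ℝ^n. Consider gradient descent on L̃^RDI: θ(t+1) = θ(t) − η ∇_θ L̃^RDI(θ(t)) started from θ(0), and joint gradient descent on L̃^AUX: θ̄(t+1) = θ̄(t) − η ∇_θ L̃^AUX(θ̄(t), b(t)), b(t+1) = b(t) − η ∇_b L̃^AUX(θ̄(t), b(t)), started from θ̄(0) = θ(0) and b(0) = 0. Then θ(t) = θ̄(t) for every t ≥ 0. -/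
open scoped RealInnerProductSpace

theorem aux_grad {E : Type*} [NormedAddCommGroup E] [InnerProductSpace ℝ E] [CompleteSpace E]
    {n : ℕ} (a : Fin n → E) (k : Fin n → ℝ) (m : ℝ) (c w : E) :
    gradient (fun w => (1/2) * (∑ i, (⟪a i, w - c⟫ + k i)^2) + (m / 2) * ‖w - c‖^2) w
      = ∑ i, (⟪a i, w - c⟫ + k i) • a i + m • (w - c) := by
  apply HasGradientAt.gradient
  rw [hasGradientAt_iff_hasFDerivAt]
  have hid : HasFDerivAt (fun w : E => w - c) (ContinuousLinearMap.id ℝ E) w :=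
    (hasFDerivAt_id w).sub_const c
  have h1 : ∀ i ∈ Finset.univ, HasFDerivAt (fun w => (⟪a i, w - c⟫ + k i)^2) _ w := fun i _ =>
    ((((innerSL ℝ (a i)).hasFDerivAt.comp w hid).add_const (k i)).pow 2)
  have h2 := ((HasFDerivAt.fun_sum h1).const_mul (1/2)).add (hid.norm_sq.const_mul (m/2))
  refine h2.congr_fderiv ?_
  ext v
  simp [Finset.mul_sum, innerSL_apply_apply]
  congr 1
  · exact Finset.sum_congr rfl fun i _ => by ring
  · ring

/-- gradient descent on the linearized RDI objective and joint gradient descent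
on the linearized AUX objective (started from the same initialization, with `b(0) = 0`)
produce the same parameter iterates. -/
theorem stmt_0 {N n : ℕ} (θ0 : EuclideanSpace ℝ (Fin N))
    (φ : Fin n → EuclideanSpace ℝ (Fin N)) (ytil : Fin n → ℝ)
    (lam η : ℝ) (hlam : 0 < lam) (hη : 0 < η)
    (LRDI : EuclideanSpace ℝ (Fin N) → ℝ)
    (hLRDI : LRDI = fun w =>
      (1/2) * (∑ i, (⟪φ i, w - θ0⟫ - ytil i)^2) + (lam^2 / 2) * ‖w - θ0‖^2)
    (LAUX : EuclideanSpace ℝ (Fin N) → EuclideanSpace ℝ (Fin n) → ℝ)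
    (hLAUX : LAUX = fun w b =>
      (1/2) * (∑ i, (⟪φ i, w - θ0⟫ + lam * b i - ytil i)^2))
    (θ θbar : ℕ → EuclideanSpace ℝ (Fin N)) (b : ℕ → EuclideanSpace ℝ (Fin n))
    (hθ0 : θ 0 = θ0)
    (hθ : ∀ t, θ (t+1) = θ t - η • gradient LRDI (θ t))
    (hθbar0 : θbar 0 = θ0) (hb0 : b 0 = 0)
    (hθbar : ∀ t, θbar (t+1) = θbar t - η • gradient (fun w => LAUX w (b t)) (θbar t))
    (hb : ∀ t, b (t+1) = b t - η • gradient (fun v => LAUX (θbar t) v) (b t)) :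
    ∀ t, θ t = θbar t := by
  have e1 : ∀ w, gradient LRDI w
      = ∑ i, (⟪φ i, w - θ0⟫ + -ytil i) • φ i + (lam^2) • (w - θ0) := by
    intro w
    rw [← aux_grad, hLRDI]
    simp only [sub_eq_add_neg]
  have e2 : ∀ v w, gradient (fun w => LAUX w v) w
      = ∑ i, (⟪φ i, w - θ0⟫ + (lam * v i - ytil i)) • φ i := by
    intro v w
    have := aux_grad φ (fun i => lam * v i - ytil i) 0 θ0 w
    simp only [zero_div, zero_mul, add_zero, zero_smul] at this
    rw [← this, hLAUX]
    simp only [add_sub_assoc]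
  have e3 : ∀ v w i, gradient (fun v => LAUX w v) v i
      = lam * (⟪φ i, w - θ0⟫ + (lam * v i - ytil i)) := by
    intro v w i
    have := aux_grad (fun i => lam • EuclideanSpace.single i (1:ℝ))
      (fun i => ⟪φ i, w - θ0⟫ - ytil i) 0 0 v
    simp only [zero_div, zero_mul, add_zero, zero_smul, sub_zero, inner_smul_left,
      EuclideanSpace.inner_single_left, map_one, one_mul, conj_trivial] at this
    have h : (fun v => LAUX w v) = fun v : EuclideanSpace ℝ (Fin n) =>
        (1/2) * (∑ i, (lam * v i + (⟪φ i, w - θ0⟫ - ytil i))^2) := by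
      rw [hLAUX]; funext v; refine congrArg (fun x => (1/2) * x) ?_
      exact Finset.sum_congr rfl fun i _ => by ring
    rw [h, this]
    simp [Pi.single_apply]
    ring
  have key : ∀ t, ∑ i, (b t i) • φ i = lam • (θbar t - θ0) := by
    intro t
    induction t with
    | zero => simp [hb0, hθbar0]
    | succ t ih =>
      have : ∀ i, b (t+1) i = b t i
          - η * (lam * (⟪φ i, θbar t - θ0⟫ + (lam * b t i - ytil i))) := by
        intro i
        rw [hb, ← e3]
        simp
      simp only [this, sub_smul, Finset.sum_sub_distrib, ih, hθbar, e2, mul_smul, ← Finset.smul_sum]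
      module
  intro t
  induction t with
  | zero => rw [hθ0, hθbar0]
  | succ t ih =>
    rw [hθ, hθbar, ih, e1, e2]
    congr 2
    rw [pow_two, mul_smul, ← key, Finset.smul_sum, ← Finset.sum_add_distrib]
    exact Finset.sum_congr rfl fun i _ => by module
end

section
/- Let K ∈ ℝ^{n×n} be a symmetric positive semidefinite matrix and λ > 0. Setting A = K(K + λ² I)⁻¹, one has tr[A²] ≤ tr[K]/(4λ²). -/
open Matrix

/-- for PSD `K` and `λ > 0`, with `A = K (K + λ² I)⁻¹`, `tr[A²] ≤ tr[K] / (4λ²)`. -/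
theorem stmt_5 {n : ℕ} (K : Matrix (Fin n) (Fin n) ℝ) (hK : K.PosSemidef)
    (lam : ℝ) (hlam : 0 < lam)
    (A : Matrix (Fin n) (Fin n) ℝ)
    (hA : A = K * (K + lam^2 • (1 : Matrix (Fin n) (Fin n) ℝ))⁻¹) :
    (A * A).trace ≤ K.trace / (4 * lam^2) := by
  obtain ⟨d, hd, φ, htr, hKd⟩ : ∃ d : Fin n → ℝ, (∀ i, 0 ≤ d i) ∧
      ∃ φ : Matrix (Fin n) (Fin n) ℝ ≃⋆ₐ[ℝ] Matrix (Fin n) (Fin n) ℝ,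
        (∀ M, (φ M).trace = M.trace) ∧ K = φ (diagonal d) := by
    refine ⟨hK.1.eigenvalues, hK.eigenvalues_nonneg,
      Unitary.conjStarAlgAut ℝ _ hK.1.eigenvectorUnitary, ?_, ?_⟩
    · intro M
      rw [Unitary.conjStarAlgAut_apply, Matrix.trace_mul_comm, ← mul_assoc]
      simp
    · exact hK.1.spectral_theorem
  have hl : 0 < lam ^ 2 := by positivity
  have hpos : ∀ i, 0 < d i + lam ^ 2 := fun i => by linarith [hd i]
  have hinv : (K + lam^2 • (1 : Matrix (Fin n) (Fin n) ℝ))⁻¹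
      = φ (diagonal fun i => (d i + lam ^ 2)⁻¹) := by
    apply Matrix.inv_eq_right_inv
    have h1 : K + lam^2 • (1 : Matrix (Fin n) (Fin n) ℝ)
        = φ (diagonal fun i => d i + lam ^ 2) := by
      have h2 : (diagonal fun i => d i + lam ^ 2)
          = diagonal d + lam ^ 2 • (1 : Matrix (Fin n) (Fin n) ℝ) := by
        rw [Matrix.smul_one_eq_diagonal, Matrix.diagonal_add]
      rw [h2, map_add, map_smul, map_one, hKd]
    rw [h1, ← map_mul, Matrix.diagonal_mul_diagonal]
    have h3 : (fun i => (d i + lam ^ 2) * (d i + lam ^ 2)⁻¹) = fun _ => (1 : ℝ) :=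
      funext fun i => mul_inv_cancel₀ (hpos i).ne'
    rw [h3, Matrix.diagonal_one, map_one]
  rw [hA, hinv, hKd, ← map_mul, ← map_mul, htr, htr]
  simp only [Matrix.diagonal_mul_diagonal, Matrix.trace_diagonal]
  rw [Finset.sum_div]
  refine Finset.sum_le_sum fun i _ => ?_
  have hp := hpos i
  have e : d i * (d i + lam ^ 2)⁻¹ * (d i * (d i + lam ^ 2)⁻¹)
      = d i * d i / (d i + lam ^ 2) ^ 2 := by field_simp
  rw [e, div_le_div_iff₀ (by positivity) (by positivity)]
  have := mul_nonneg (hd i) (sq_nonneg (d i - lam ^ 2))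
  nlinarith
end

section
/- Let K ∈ ℝ^{n×n} be a symmetric positive definite matrix, λ > 0, and y, ε ∈ ℝ^n. Then √((y + ε)ᵀ (K + λ² I)⁻¹ (y + ε)) ≤ √(yᵀ (K + λ² I)⁻¹ y) + ‖ε‖/λ, and moreover √(yᵀ (K + λ² I)⁻¹ y) ≤ √(yᵀ K⁻¹ y). -/
open Matrix

/-- The Euclidean norm of a vector in `Fin n → ℝ`. -/
noncomputable def enorm10 {n : ℕ} (v : Fin n → ℝ) : ℝ := Real.sqrt (∑ i, (v i)^2)

theorem aux_symm {n : ℕ} {A : Matrix (Fin n) (Fin n) ℝ} (hA : A.IsHermitian)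
    (x y : Fin n → ℝ) : x ⬝ᵥ A.mulVec y = y ⬝ᵥ A.mulVec x := by
  have h : Aᵀ = A := by simpa [Matrix.IsHermitian] using hA
  rw [dotProduct_mulVec, ← mulVec_transpose, h, dotProduct_comm]

theorem aux_nonneg {n : ℕ} {A : Matrix (Fin n) (Fin n) ℝ} (hA : A.PosSemidef)
    (x : Fin n → ℝ) : 0 ≤ x ⬝ᵥ A.mulVec x := by
  simpa using hA.dotProduct_mulVec_nonneg x

theorem aux_inv {n : ℕ} {A C : Matrix (Fin n) (Fin n) ℝ} (hA : A.PosDef)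
    (hC : C.PosSemidef) (v : Fin n → ℝ) :
    v ⬝ᵥ (A + C)⁻¹.mulVec v ≤ v ⬝ᵥ A⁻¹.mulVec v := by
  have hM : (A + C).PosDef := hA.add_posSemidef hC
  have hAu : A.mulVec (A⁻¹.mulVec v) = v := by
    rw [mulVec_mulVec, mul_nonsing_inv _ ((isUnit_iff_isUnit_det _).1 hA.isUnit), one_mulVec]
  have hMw : (A + C).mulVec ((A + C)⁻¹.mulVec v) = v := by
    rw [mulVec_mulVec, mul_nonsing_inv _ ((isUnit_iff_isUnit_det _).1 hM.isUnit), one_mulVec]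
  generalize A⁻¹.mulVec v = u at *
  generalize (A + C)⁻¹.mulVec v = w at *
  have h1 := aux_nonneg hA.posSemidef (u - w)
  have h2 := aux_nonneg hC w
  have h3 := aux_symm hA.isHermitian u w
  have h4 : w ⬝ᵥ (A + C).mulVec w = w ⬝ᵥ v := by rw [hMw]
  rw [add_mulVec, dotProduct_add] at h4
  rw [mulVec_sub, sub_dotProduct, dotProduct_sub, dotProduct_sub, h3, hAu] at h1
  rw [dotProduct_comm v w, dotProduct_comm v u]
  linarith

theorem aux_tri {n : ℕ} {B : Matrix (Fin n) (Fin n) ℝ} (hB : B.PosSemidef)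
    (x y : Fin n → ℝ) :
    Real.sqrt ((x + y) ⬝ᵥ B.mulVec (x + y)) ≤
      Real.sqrt (x ⬝ᵥ B.mulVec x) + Real.sqrt (y ⬝ᵥ B.mulVec y) := by
  have h3 := aux_symm hB.isHermitian x y
  have ha := aux_nonneg hB x
  have hb := aux_nonneg hB y
  have hd : ∀ t : ℝ, 0 ≤ (x ⬝ᵥ B.mulVec x) * (t * t) + (2 * (y ⬝ᵥ B.mulVec x)) * t
      + y ⬝ᵥ B.mulVec y := by
    intro t
    have := aux_nonneg hB (t • x + y)
    simp only [mulVec_add, mulVec_smul, add_dotProduct, dotProduct_add, smul_dotProduct,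
      dotProduct_smul, smul_eq_mul, h3] at this
    linarith
  have hdis := discrim_le_zero hd
  unfold discrim at hdis
  have hc : y ⬝ᵥ B.mulVec x ≤ Real.sqrt (x ⬝ᵥ B.mulVec x) * Real.sqrt (y ⬝ᵥ B.mulVec y) := by
    rw [← Real.sqrt_mul ha]
    apply Real.le_sqrt_of_sq_le
    linarith
  rw [Real.sqrt_le_iff]
  refine ⟨by positivity, ?_⟩
  have e1 := Real.sq_sqrt ha
  have e2 := Real.sq_sqrt hb
  simp only [mulVec_add, add_dotProduct, dotProduct_add, h3]
  nlinarith

/-- triangle-type inequality for the norm induced by `(K + λ² I)⁻¹`,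
and comparison with the norm induced by `K⁻¹`. -/
theorem stmt_10 {n : ℕ} (K : Matrix (Fin n) (Fin n) ℝ) (hK : K.PosDef)
    (lam : ℝ) (hlam : 0 < lam) (y ε : Fin n → ℝ)
    (B : Matrix (Fin n) (Fin n) ℝ)
    (hB : B = (K + lam^2 • (1 : Matrix (Fin n) (Fin n) ℝ))⁻¹) :
    Real.sqrt ((y + ε) ⬝ᵥ B.mulVec (y + ε)) ≤
      Real.sqrt (y ⬝ᵥ B.mulVec y) + enorm10 ε / lam ∧
    Real.sqrt (y ⬝ᵥ B.mulVec y) ≤ Real.sqrt (y ⬝ᵥ K⁻¹.mulVec y) := by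
  have hI : (lam^2 • (1 : Matrix (Fin n) (Fin n) ℝ)).PosDef :=
    Matrix.PosDef.one.smul (by positivity)
  have hBp : B.PosSemidef := hB ▸ (hK.add hI).inv.posSemidef
  constructor
  · refine (aux_tri hBp y ε).trans (add_le_add le_rfl ?_)
    have h := aux_inv hI hK.posSemidef ε
    rw [add_comm, ← hB] at h
    have hinv : (lam^2 • (1 : Matrix (Fin n) (Fin n) ℝ))⁻¹ = (lam^2)⁻¹ • 1 := by
      apply inv_eq_right_inv
      rw [smul_mul_smul_comm, mul_inv_cancel₀ (by positivity), one_mul, one_smul]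
    rw [hinv, smul_mulVec, one_mulVec, dotProduct_smul, smul_eq_mul] at h
    have h5 : enorm10 ε / lam = Real.sqrt ((lam^2)⁻¹ * (ε ⬝ᵥ ε)) := by
      rw [Real.sqrt_mul (by positivity), Real.sqrt_inv, Real.sqrt_sq hlam.le]
      simp only [enorm10, dotProduct, sq]
      rw [div_eq_inv_mul]
    rw [h5]
    exact Real.sqrt_le_sqrt h
  · rw [hB]
    exact Real.sqrt_le_sqrt (aux_inv hK hI.posSemidef y)
end

section
/- Let K ∈ ℝ^{n×n} be a symmetric positive definite matrix, λ > 0, and y, ε ∈ ℝ^n, and set ỹ = y + ε. Then ‖K(K + λ² I)⁻¹ ỹ − y‖ ≤ ‖K(K + λ² I)⁻¹ ε‖ + (λ/2)·√(yᵀ K⁻¹ y). -/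
open Matrix

/-- The Euclidean norm of a vector in `Fin n → ℝ`. -/
noncomputable def enorm11 {n : ℕ} (v : Fin n → ℝ) : ℝ := Real.sqrt (∑ i, (v i)^2)

lemma enorm11_eq {n : ℕ} (v : Fin n → ℝ) : enorm11 v = ‖WithLp.toLp 2 v‖ := by
  simp [enorm11, EuclideanSpace.norm_eq]

lemma enorm11_sub_le {n : ℕ} (v w : Fin n → ℝ) : enorm11 (v - w) ≤ enorm11 v + enorm11 w := by
  rw [enorm11_eq, enorm11_eq, enorm11_eq, WithLp.toLp_sub]
  exact norm_sub_le _ _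

/-- the kernel ridge regression training residual against the clean targets
is bounded by the noise term plus `(λ/2) √(yᵀ K⁻¹ y)`. -/
theorem stmt_11 {n : ℕ} (K : Matrix (Fin n) (Fin n) ℝ) (hK : K.PosDef)
    (lam : ℝ) (hlam : 0 < lam) (y ε : Fin n → ℝ)
    (ytil : Fin n → ℝ) (hytil : ytil = y + ε) :
    enorm11 ((K * (K + lam^2 • (1 : Matrix (Fin n) (Fin n) ℝ))⁻¹).mulVec ytil - y) ≤
      enorm11 ((K * (K + lam^2 • (1 : Matrix (Fin n) (Fin n) ℝ))⁻¹).mulVec ε) +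
        (lam / 2) * Real.sqrt (y ⬝ᵥ K⁻¹.mulVec y) := by
  subst hytil
  have hl2 : 0 < lam ^ 2 := by positivity
  have hA : (K + lam^2 • (1 : Matrix (Fin n) (Fin n) ℝ)).PosDef :=
    hK.add (Matrix.PosDef.one.smul hl2)
  have hAu := (Matrix.isUnit_iff_isUnit_det _).1 hA.isUnit
  have hKu := (Matrix.isUnit_iff_isUnit_det _).1 hK.isUnit
  set A := K + lam^2 • (1 : Matrix (Fin n) (Fin n) ℝ) with hAdef
  obtain ⟨z, hz⟩ : ∃ z, z = A⁻¹ *ᵥ y := ⟨_, rfl⟩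
  obtain ⟨u, hu⟩ : ∃ u, u = K⁻¹ *ᵥ z := ⟨_, rfl⟩
  have hy : y = K *ᵥ z + lam ^ 2 • z := by
    have h1 : A *ᵥ z = y := by
      rw [hz, Matrix.mulVec_mulVec, Matrix.mul_nonsing_inv _ hAu, Matrix.one_mulVec]
    rw [← h1, hAdef, Matrix.add_mulVec, Matrix.smul_mulVec, Matrix.one_mulVec]
  have hKuz : K *ᵥ u = z := by
    rw [hu, Matrix.mulVec_mulVec, Matrix.mul_nonsing_inv _ hKu, Matrix.one_mulVec]
  have hKy : K⁻¹ *ᵥ y = z + lam ^ 2 • u := by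
    rw [hy, Matrix.mulVec_add, Matrix.mulVec_mulVec, Matrix.nonsing_inv_mul _ hKu,
      Matrix.one_mulVec, Matrix.mulVec_smul, hu]
  have hsym : u ⬝ᵥ K *ᵥ z = z ⬝ᵥ z := by
    have hT : Kᵀ = K := by simpa using hK.isHermitian.eq
    rw [Matrix.dotProduct_mulVec, ← Matrix.mulVec_transpose, hT, hKuz]
  have hpos : 0 ≤ (z - lam ^ 2 • u) ⬝ᵥ K *ᵥ (z - lam ^ 2 • u) := by
    simpa using hK.posSemidef.dotProduct_mulVec_nonneg (z - lam ^ 2 • u)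
  have hres : (K * A⁻¹) *ᵥ (y + ε) - y = (K * A⁻¹) *ᵥ ε - lam ^ 2 • z := by
    rw [Matrix.mulVec_add, ← Matrix.mulVec_mulVec, ← hz]
    rw [hy]
    abel
  rw [hres]
  refine (enorm11_sub_le _ _).trans ?_
  gcongr
  have hn : ∑ i, ((lam ^ 2 • z) i) ^ 2 = lam ^ 4 * (z ⬝ᵥ z) := by
    simp only [dotProduct, Finset.mul_sum, Pi.smul_apply, smul_eq_mul]
    exact Finset.sum_congr rfl fun i _ => by ring
  rw [enorm11, hn]
  apply Real.sqrt_le_iff.2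
  have key : 4 * lam ^ 2 * (z ⬝ᵥ z) ≤ y ⬝ᵥ K⁻¹ *ᵥ y := by
    rw [hKy, hy]
    rw [Matrix.mulVec_sub, Matrix.mulVec_smul, hKuz] at hpos
    simp only [sub_dotProduct, dotProduct_sub, add_dotProduct, dotProduct_add, smul_dotProduct,
      dotProduct_smul, smul_eq_mul, hsym] at hpos ⊢
    rw [dotProduct_comm (K *ᵥ z) z, dotProduct_comm (K *ᵥ z) u, hsym, dotProduct_comm z u]
    linarith
  have hzz : 0 ≤ z ⬝ᵥ z := by
    exact Finset.sum_nonneg fun i _ => mul_self_nonneg (z i)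
  refine ⟨by positivity, ?_⟩
  rw [mul_pow, Real.sq_sqrt (le_trans (by positivity) key)]
  nlinarith [mul_le_mul_of_nonneg_left key hl2.le]
end

section
/- Let K ≥ 2, let P ∈ ℝ^{K×K} be a matrix with entries p_{c',c}, let gap > 0, and suppose p_{c,c} − p_{c',c} ≥ gap for all c, c' ∈ {1,…,K} with c' ≠ c. Let f ∈ ℝ^K, let c ∈ {1,…,K}, and suppose c is not a maximizer of h ↦ f_h, i.e., there exists h ∈ {1,…,K} with f_h > f_c. Then Σ_{h=1}^K |f_h − p_{h,c}| ≥ gap. -/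
open scoped Matrix

/-- if `c` is not a maximizer of `f`, then the total deviation of `f`
from the `c`-th column of `P` is at least `gap`. -/
theorem stmt_17 {K : ℕ} (hK : 2 ≤ K)
    (P : Matrix (Fin K) (Fin K) ℝ) (gap : ℝ) (hgap : 0 < gap)
    (hP : ∀ c c' : Fin K, c' ≠ c → gap ≤ P c c - P c' c)
    (f : Fin K → ℝ) (c : Fin K) (hc : ∃ h : Fin K, f c < f h) :
    gap ≤ ∑ h : Fin K, |f h - P h c| := by
  obtain ⟨h, hh⟩ := hc
  have hne : h ≠ c := by
    rintro rfl
    exact lt_irrefl _ hh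
  have h1 := hP c h hne
  have h2 : ∑ x ∈ ({h, c} : Finset (Fin K)), |f x - P x c| ≤ ∑ x : Fin K, |f x - P x c| :=
    Finset.sum_le_sum_of_subset_of_nonneg (Finset.subset_univ _) (fun _ _ _ => abs_nonneg _)
  rw [Finset.sum_pair hne] at h2
  have h3 := le_abs_self (f h - P h c)
  have h4 := neg_abs_le (f c - P c c)
  linarith
end
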